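/- Let ν ∈ (0,1), S, U > 0, R = 0 and T = 1/2. Then det( A(ν,θ;R,S,T,U) − e^{−Iνθ}·Id ) = O(θ³) as θ → 0, i.e., the principal eigenvalue of A agrees with e^{−Iνθ} to second order in θ. -/

import Mathlib

open Complex Matrix

/-- The amplification matrix of the parameterized Active Flux scheme. -/
noncomputable def ampMatrix (ν θ R S T U : ℝ) : Matrix (Fin 2) (Fin 2) ℂ :=
  !![1 - (ν : ℂ) * (1 + (1 - (ν : ℂ)) * ((U : ℂ) - (T : ℂ))) *
        (1 - Complex.exp (-Complex.I * (θ : ℂ))),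
      (ν : ℂ) * (1 - (ν : ℂ)) * ((U : ℂ) * Complex.exp (-Complex.I * (θ : ℂ)) - (T : ℂ)) *
        (1 - Complex.exp (-Complex.I * (θ : ℂ)));
      (ν : ℂ) * (1 - (ν : ℂ)) * ((R : ℂ) + (S : ℂ)),
      (1 - (ν : ℂ)) * (1 - (ν : ℂ) * (R : ℂ)) +
        (ν : ℂ) * (1 - (1 - (ν : ℂ)) * (S : ℂ)) * Complex.exp (-Complex.I * (θ : ℂ))]

open Asymptotics Filter Topology in
lemma exp_mul_ofReal_sub_quadratic_isBigO (c : ℂ) :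
    (fun θ : ℝ => Complex.exp (c * θ) - (1 + c * θ + (c * θ) ^ 2 / 2))
      =O[𝓝 0] fun θ : ℝ => θ ^ 3 := by
  have hlim : Tendsto (fun θ : ℝ => c * (θ : ℂ)) (𝓝 0) (𝓝 0) := by
    have : Continuous fun θ : ℝ => c * (θ : ℂ) := by fun_prop
    simpa using this.tendsto 0
  have hlin : (fun θ : ℝ => c * (θ : ℂ)) =O[𝓝 0] fun θ : ℝ => θ :=
    (isBigO_of_le _ fun θ => by simp).const_mul_left c
  refine (((Complex.exp_sub_sum_range_isBigO_pow 3).comp_tendsto hlim).trans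
    (hlin.pow 3)).congr_left fun θ => ?_
  simp [Finset.sum_range_succ]

/-- The determinant at `R = 0`, `T = 1 / 2`, in terms of `w = 1 - exp (-I θ)` and
`d = 1 - p - ν w`; each term is of third order when `p = exp (-I ν θ)`. -/
lemma det_ampMatrix_sub_smul_one (ν θ S U : ℝ) (p w d : ℂ)
    (hw : w = 1 - Complex.exp (-Complex.I * (θ : ℂ))) (hd : d = 1 - p - ν * w) :
    Matrix.det (ampMatrix ν θ 0 S (1 / 2) U - p • (1 : Matrix (Fin 2) (Fin 2) ℂ)) =
      d * d + (ν * (1 - ν) * (S - U + 1 / 2)) * (d * w) -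
        (ν * (1 - ν) * S) * (d - ν * (1 - ν) / 2 * (w * w)) := by
  subst hd hw
  simp only [ampMatrix, Matrix.det_fin_two, Matrix.sub_apply, Matrix.smul_apply,
    Matrix.of_apply, Matrix.cons_val', Matrix.cons_val_zero, Matrix.cons_val_one,
    Matrix.cons_val_fin_one, Matrix.one_apply, smul_eq_mul]
  push_cast
  simp
  ring

open Asymptotics Filter Topology in
theorem principal_eigenvalue_second_order_correct_degenerate (ν S U : ℝ)
    (hν : ν ∈ Set.Ioo (0 : ℝ) 1) (hS : 0 < S) (hU : 0 < U) :
    (fun θ : ℝ => Matrix.det (ampMatrix ν θ 0 S (1 / 2) U -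
        Complex.exp (-Complex.I * (ν : ℂ) * (θ : ℂ)) • (1 : Matrix (Fin 2) (Fin 2) ℂ)))
      =O[𝓝 0] fun θ : ℝ => θ ^ 3 := by
  let w : ℝ → ℂ := fun θ => 1 - Complex.exp (-Complex.I * θ)
  let d : ℝ → ℂ := fun θ => 1 - Complex.exp (-Complex.I * ν * θ) - ν * w θ
  have pow_le {m n : ℕ} (h : m < n) : (fun θ : ℝ => θ ^ n) =O[𝓝 0] fun θ : ℝ => θ ^ m :=
    (isLittleO_pow_pow h).isBigO
  have hpow (n : ℕ) : (fun θ : ℝ => (θ : ℂ) ^ n) =O[𝓝 0] fun θ : ℝ => θ ^ n :=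
    isBigO_of_le _ fun θ => by simp
  have h₁ := exp_mul_ofReal_sub_quadratic_isBigO (-Complex.I)
  have h₂ := exp_mul_ofReal_sub_quadratic_isBigO (-Complex.I * ν)
  have hwz : (fun θ : ℝ => w θ - Complex.I * θ) =O[𝓝 0] fun θ : ℝ => θ ^ 2 := by
    refine (((hpow 2).const_mul_left (1 / 2)).sub (h₁.trans (pow_le (by norm_num)))).congr_left
      fun θ => ?_
    simp only [w]
    linear_combination ((θ : ℂ) ^ 2 / 2) * Complex.I_sq
  have hw : w =O[𝓝 0] fun θ : ℝ => θ ^ 1 := by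
    refine ((hwz.trans (pow_le (by norm_num))).add
      ((hpow 1).const_mul_left Complex.I)).congr_left fun θ => ?_
    ring
  have hdz : (fun θ : ℝ => d θ + ν * (1 - ν) / 2 * (θ : ℂ) ^ 2)
      =O[𝓝 0] fun θ : ℝ => θ ^ 3 := by
    refine ((h₁.const_mul_left (ν : ℂ)).sub h₂).congr_left fun θ => ?_
    simp only [d, w]
    linear_combination (-ν * (1 - ν) / 2 * (θ : ℂ) ^ 2) * Complex.I_sq
  have hd : d =O[𝓝 0] fun θ : ℝ => θ ^ 2 := by
    refine ((hdz.trans (pow_le (by norm_num))).sub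
      ((hpow 2).const_mul_left (ν * (1 - ν) / 2 : ℂ))).congr_left fun θ => ?_
    ring
  have hww : (fun θ : ℝ => w θ * w θ + (θ : ℂ) ^ 2) =O[𝓝 0] fun θ : ℝ => θ ^ 3 := by
    refine ((hwz.mul (hw.add ((hpow 1).const_mul_left Complex.I))).congr_left
      fun θ => ?_).congr_right fun θ => ?_
    · linear_combination (-(θ : ℂ) ^ 2) * Complex.I_sq
    · ring
  have hdww : (fun θ : ℝ => d θ - ν * (1 - ν) / 2 * (w θ * w θ))
      =O[𝓝 0] fun θ : ℝ => θ ^ 3 := by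
    refine (hdz.sub (hww.const_mul_left (ν * (1 - ν) / 2 : ℂ))).congr_left fun θ => ?_
    ring
  have hdd : (fun θ : ℝ => d θ * d θ) =O[𝓝 0] fun θ : ℝ => θ ^ 3 :=
    ((hd.mul hd).congr_right fun θ => (pow_add θ 2 2).symm).trans (pow_le (by norm_num))
  have hdw : (fun θ : ℝ => d θ * w θ) =O[𝓝 0] fun θ : ℝ => θ ^ 3 :=
    (hd.mul hw).congr_right fun θ => (pow_add θ 2 1).symm
  exact ((hdd.add (hdw.const_mul_left (ν * (1 - ν) * (S - U + 1 / 2) : ℂ))).sub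
    (hdww.const_mul_left (ν * (1 - ν) * S : ℂ))).congr_left fun θ =>
      (det_ampMatrix_sub_smul_one ν θ S U _ (w θ) (d θ) rfl rfl).symm
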